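/- For all p ∈ ℕ and q ≥ 1, the derivation L := z₁·∂/∂z̄₂ − z₂·∂/∂z̄₁ restricts to a ℂ-linear bijection from H_{p,q} onto H_{p+1,q−1}; i.e., the tangential Cauchy–Riemann differential ∂̄_b gives an isomorphism H_{j,j̄} ≅ H_{j+1/2, j̄−1/2} of spaces of S³ harmonics for j̄ ≥ 1/2. -/

import Mathlib

open MvPolynomial

noncomputable section

/-- The polynomial ring `𝒫 = ℂ[z₁,z₂,z̄₁,z̄₂]`, with variables indexed so that
`X 0 = z₁`, `X 1 = z₂`, `X 2 = z̄₁`, `X 3 = z̄₂`. -/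
abbrev P4 : Type := MvPolynomial (Fin 4) ℂ

/-- The Laplacian `Δ = ∂²/∂z₁∂z̄₁ + ∂²/∂z₂∂z̄₂`. -/
def lap (f : P4) : P4 :=
  pderiv (2 : Fin 4) (pderiv (0 : Fin 4) f) + pderiv (3 : Fin 4) (pderiv (1 : Fin 4) f)

/-- The polynomial `‖z‖² = z₁z̄₁ + z₂z̄₂`. -/
def normSqPoly : P4 := X 0 * X 2 + X 1 * X 3

/-- `f` is bihomogeneous of bidegree `(p,q)`: every monomial occurring in it has total
degree `p` in `(z₁,z₂)` and total degree `q` in `(z̄₁,z̄₂)`.  The set of such `f` is `V_{p,q}`. -/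
def IsBihom (p q : ℕ) (f : P4) : Prop :=
  ∀ d ∈ f.support, d 0 + d 1 = p ∧ d 2 + d 3 = q

/-- The derivation `L = z₁·∂/∂z̄₂ − z₂·∂/∂z̄₁`, representing the tangential Cauchy–Riemann
operator `∂̄_b` on `S³`. -/
def Lop (f : P4) : P4 :=
  X 0 * pderiv (3 : Fin 4) f - X 1 * pderiv (2 : Fin 4) f

set_option linter.unusedSimpArgs false

theorem pd_comm (i j : Fin 4) (f : P4) : pderiv i (pderiv j f) = pderiv j (pderiv i f) := by
  have h : ⁅(pderiv i : Derivation ℂ P4 P4), (pderiv j : Derivation ℂ P4 P4)⁆ = 0 := by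
    apply MvPolynomial.derivation_ext
    intro k
    rw [Derivation.commutator_apply, pderiv_X, pderiv_X]
    have h1 : ∀ a b c : Fin 4, pderiv a ((Pi.single b (1 : P4) : Fin 4 → P4) c) = 0 := by
      intro a b c
      by_cases hbc : c = b
      · subst hbc; simp
      · simp [hbc]
    rw [h1, h1]; simp
  have h2 := congrArg (fun D => D f) h
  simp only [Derivation.commutator_apply, Derivation.zero_apply] at h2
  exact sub_eq_zero.mp h2

theorem supp_aux (i j : Fin 4) (f : P4) (d : Fin 4 →₀ ℕ) (hd : d ∈ (X i * pderiv j f).support) :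
    ∃ m : Fin 4 →₀ ℕ, d = m + Finsupp.single i 1 ∧ m + Finsupp.single j 1 ∈ f.support := by
  classical
  rw [support_X_mul] at hd
  obtain ⟨m, hm, rfl⟩ := Finset.mem_map.mp hd
  refine ⟨m, by simp [add_comm], ?_⟩
  rw [mem_support_iff, coeff_pderiv] at hm
  rw [mem_support_iff]
  intro h0
  apply hm
  simp [h0]

theorem coeff_euler (i : Fin 4) (f : P4) (d : Fin 4 →₀ ℕ) :
    coeff d (X i * pderiv i f) = (d i : ℂ) * coeff d f := by
  classical
  rw [coeff_X_mul']
  split_ifs with h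
  · rw [coeff_pderiv]
    have h1 : 1 ≤ d i := Nat.one_le_iff_ne_zero.mpr (Finsupp.mem_support_iff.mp h)
    have h2 : d - Finsupp.single i 1 + Finsupp.single i 1 = d := by
      apply tsub_add_cancel_of_le
      simpa using h1
    rw [h2]
    have h3 : (((d - Finsupp.single i 1 : Fin 4 →₀ ℕ) i : ℕ) : ℂ) + 1 = d i := by
      have : (d - Finsupp.single i 1 : Fin 4 →₀ ℕ) i + 1 = d i := by
        simp; omega
      exact_mod_cast this
    rw [← h3]; ring
  · have : d i = 0 := by simpa using h
    simp [this]

theorem euler1 {p q : ℕ} {f : P4} (hf : IsBihom p q f) :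
    X 0 * pderiv 0 f + X 1 * pderiv 1 f = (p : P4) * f := by
  ext d
  rw [coeff_add, coeff_euler, coeff_euler, ← map_natCast (C : ℂ →+* P4), coeff_C_mul]
  by_cases h : d ∈ f.support
  · rw [← (hf d h).1]; push_cast; ring
  · rw [notMem_support_iff.mp h]; simp

theorem euler2 {p q : ℕ} {f : P4} (hf : IsBihom p q f) :
    X 2 * pderiv 2 f + X 3 * pderiv 3 f = (q : P4) * f := by
  ext d
  rw [coeff_add, coeff_euler, coeff_euler, ← map_natCast (C : ℂ →+* P4), coeff_C_mul]
  by_cases h : d ∈ f.support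
  · rw [← (hf d h).2]; push_cast; ring
  · rw [notMem_support_iff.mp h]; simp

def Mop (f : P4) : P4 := X 3 * pderiv (0 : Fin 4) f - X 2 * pderiv (1 : Fin 4) f

theorem bihom_sub {p q : ℕ} {f g : P4} (hf : IsBihom p q f) (hg : IsBihom p q g) :
    IsBihom p q (f - g) := by
  classical
  intro d hd
  rcases Finset.mem_union.mp (support_sub _ f g hd) with h | h
  · exact hf d h
  · exact hg d h

theorem bihom_L {p q : ℕ} {f : P4} (hf : IsBihom p q f) : IsBihom (p + 1) (q - 1) (Lop f) := by
  apply bihom_sub <;> intro d hd <;> obtain ⟨m, rfl, hm⟩ := supp_aux _ _ _ _ hd <;>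
    have := hf _ hm <;> simp [Finsupp.single_apply] at this ⊢ <;> omega

theorem bihom_M {p q : ℕ} {f : P4} (hf : IsBihom (p + 1) q f) : IsBihom p (q + 1) (Mop f) := by
  apply bihom_sub <;> intro d hd <;> obtain ⟨m, rfl, hm⟩ := supp_aux _ _ _ _ hd <;>
    have := hf _ hm <;> simp [Finsupp.single_apply] at this ⊢ <;> omega

theorem lap_L {f : P4} (h : lap f = 0) : lap (Lop f) = 0 := by
  have h3 := congrArg (pderiv (3 : Fin 4)) h
  have h2 := congrArg (pderiv (2 : Fin 4)) h
  simp [lap, Lop, Derivation.leibniz, pderiv_X, Pi.single_apply, pd_comm 1 0, pd_comm 2 0, pd_comm 3 0,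
    pd_comm 2 1, pd_comm 3 1, pd_comm 3 2] at h2 h3 ⊢
  linear_combination X 0 * h3 - X 1 * h2

theorem lap_M {f : P4} (h : lap f = 0) : lap (Mop f) = 0 := by
  have h3 := congrArg (pderiv (0 : Fin 4)) h
  have h2 := congrArg (pderiv (1 : Fin 4)) h
  simp [lap, Mop, Derivation.leibniz, pderiv_X, Pi.single_apply, pd_comm 1 0, pd_comm 2 0, pd_comm 3 0,
    pd_comm 2 1, pd_comm 3 1, pd_comm 3 2] at h2 h3 ⊢
  linear_combination X 3 * h3 - X 2 * h2

theorem euler12 {p q : ℕ} {f : P4} (hf : IsBihom p q f) :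
    X 2 * pderiv 2 (X 0 * pderiv 0 f + X 1 * pderiv 1 f) +
      X 3 * pderiv 3 (X 0 * pderiv 0 f + X 1 * pderiv 1 f) = (p : P4) * (q : P4) * f := by
  rw [euler1 hf]
  simp only [Derivation.leibniz, Derivation.map_natCast, smul_eq_mul, mul_zero, add_zero]
  linear_combination (p : P4) * euler2 hf

theorem LM {p q : ℕ} {f : P4} (hf : IsBihom p q f) (h : lap f = 0) :
    Lop (Mop f) = (p : P4) * (q + 1) * f := by
  have e1 := euler1 hf
  have e := euler12 hf
  simp [lap, Lop, Mop, Derivation.leibniz, pderiv_X, Pi.single_apply, pd_comm 1 0, pd_comm 2 0, pd_comm 3 0,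
    pd_comm 2 1, pd_comm 3 1, pd_comm 3 2] at h e ⊢
  linear_combination e + e1 - (X 0 * X 2 + X 1 * X 3) * h

theorem ML {p q : ℕ} {f : P4} (hf : IsBihom p q f) (h : lap f = 0) :
    Mop (Lop f) = (q : P4) * (p + 1) * f := by
  have e1 := euler2 hf
  have e := euler12 hf
  simp [lap, Lop, Mop, Derivation.leibniz, pderiv_X, Pi.single_apply, pd_comm 1 0, pd_comm 2 0, pd_comm 3 0,
    pd_comm 2 1, pd_comm 3 1, pd_comm 3 2] at h e ⊢
  linear_combination e + e1 - (X 0 * X 2 + X 1 * X 3) * h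

theorem bihom_C {p q : ℕ} {f : P4} (c : ℂ) (hf : IsBihom p q f) : IsBihom p q (C c * f) := by
  intro d hd
  apply hf
  rw [mem_support_iff, coeff_C_mul] at hd
  exact mem_support_iff.mpr (right_ne_zero_of_mul hd)

theorem lap_C {f : P4} (c : ℂ) : lap (C c * f) = C c * lap f := by
  simp [lap, mul_add]

theorem L_C {f : P4} (c : ℂ) : Lop (C c * f) = C c * Lop f := by
  simp [Lop]; ring

/-- For `q ≥ 1`, `L` restricts to a `ℂ`-linear bijection `H_{p,q} → H_{p+1,q−1}`:
it maps `H_{p,q}` into `H_{p+1,q−1}`, is injective there, and is surjective onto it. -/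
theorem stmt_11 (p q : ℕ) (hq : 1 ≤ q) :
    (∀ f : P4, IsBihom p q f → lap f = 0 →
      IsBihom (p + 1) (q - 1) (Lop f) ∧ lap (Lop f) = 0) ∧
    (∀ f g : P4, IsBihom p q f → lap f = 0 → IsBihom p q g → lap g = 0 →
      Lop f = Lop g → f = g) ∧
    (∀ g : P4, IsBihom (p + 1) (q - 1) g → lap g = 0 →
      ∃ f : P4, IsBihom p q f ∧ lap f = 0 ∧ Lop f = g) := by
  obtain ⟨r, rfl⟩ : ∃ r, q = r + 1 := ⟨q - 1, by omega⟩
  refine ⟨fun f hf h => ⟨bihom_L hf, lap_L h⟩, ?_, ?_⟩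
  · intro f g hf h hg h' e
    have e1 := ML hf h
    rw [e, ML hg h'] at e1
    have hne : (((r + 1 : ℕ) : P4) * ((p : P4) + 1)) ≠ 0 := by
      have : (((r + 1) * (p + 1) : ℕ) : P4) ≠ 0 := Nat.cast_ne_zero.mpr (by positivity)
      exact_mod_cast this
    exact (mul_left_cancel₀ hne e1).symm
  · intro g hg h
    simp only [Nat.add_sub_cancel] at hg
    refine ⟨C ((((p + 1) * (r + 1) : ℕ) : ℂ)⁻¹) * Mop g, bihom_C _ (bihom_M hg), ?_, ?_⟩
    · rw [lap_C, lap_M h, mul_zero]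
    · have hne : (((p + 1) * (r + 1) : ℕ) : ℂ) ≠ 0 := Nat.cast_ne_zero.mpr (by positivity)
      have e : ((p + 1 : ℕ) : P4) * ((r : P4) + 1) = C (((p + 1) * (r + 1) : ℕ) : ℂ) := by
        rw [map_natCast]; push_cast; ring
      rw [L_C, LM hg h, e, ← mul_assoc, ← C_mul, inv_mul_cancel₀ hne, C_1, one_mul]
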